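/- For any random vectors U, V in ℝ^D and every ε > 0, d_1(U,V) ≤ 2√D · ε + d_3(U,V)/min{1, ε²}. -/

import Mathlib

open MeasureTheory ProbabilityTheory Finset

noncomputable section

/-- `ζ` is `1`-Lipschitz with respect to the Euclidean norm on `ι → ℝ`. -/
def LipschitzEuclid {ι : Type*} [Fintype ι] (ζ : (ι → ℝ) → ℝ) : Prop :=
  ∀ f g : ι → ℝ, |ζ f - ζ g| ≤ Real.sqrt (∑ i, (f i - g i) ^ 2)

/-- The Wasserstein-1 distance between the laws of `X` and `Y`, as a supremum over
`1`-Lipschitz (w.r.t. the Euclidean norm) test functions. -/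
def d1 {Ω : Type*} [MeasurableSpace Ω] {ι : Type*} [Fintype ι]
    (μ : Measure Ω) (X Y : Ω → ι → ℝ) : ℝ :=
  sSup {r | ∃ ζ : (ι → ℝ) → ℝ, LipschitzEuclid ζ ∧
    r = |(∫ ω, ζ (X ω) ∂μ) - ∫ ω, ζ (Y ω) ∂μ|}

/-- First partial derivative of `η` at `x` in coordinate `i`. -/
def pd1 {ι : Type*} [Fintype ι] [DecidableEq ι] (η : (ι → ℝ) → ℝ) (x : ι → ℝ) (i : ι) : ℝ :=
  iteratedFDeriv ℝ 1 η x fun _ => Pi.single i 1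

/-- Second partial derivative of `η` at `x` in coordinates `i, j`. -/
def pd2 {ι : Type*} [Fintype ι] [DecidableEq ι] (η : (ι → ℝ) → ℝ) (x : ι → ℝ) (i j : ι) : ℝ :=
  iteratedFDeriv ℝ 2 η x ![Pi.single i 1, Pi.single j 1]

/-- Third partial derivative of `η` at `x` in coordinates `i, j, k`. -/
def pd3 {ι : Type*} [Fintype ι] [DecidableEq ι] (η : (ι → ℝ) → ℝ) (x : ι → ℝ) (i j k : ι) : ℝ :=
  iteratedFDeriv ℝ 3 η x ![Pi.single i 1, Pi.single j 1, Pi.single k 1]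

/-- Test functions for the `d₃` metric: three times differentiable with all first, second and
third partial derivatives bounded by one. -/
def TestD3 {ι : Type*} [Fintype ι] [DecidableEq ι] (ζ : (ι → ℝ) → ℝ) : Prop :=
  ContDiff ℝ 3 ζ ∧ (∀ x i, |pd1 ζ x i| ≤ 1) ∧ (∀ x i j, |pd2 ζ x i j| ≤ 1) ∧
    (∀ x i j k, |pd3 ζ x i j k| ≤ 1)

/-- The `d₃` integral probability metric between the laws of `X` and `Y`. -/
def d3 {Ω : Type*} [MeasurableSpace Ω] {ι : Type*} [Fintype ι] [DecidableEq ι]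
    (μ : Measure Ω) (X Y : Ω → ι → ℝ) : ℝ :=
  sSup {r | ∃ ζ : (ι → ℝ) → ℝ, TestD3 ζ ∧
    r = |(∫ ω, ζ (X ω) ∂μ) - ∫ ω, ζ (Y ω) ∂μ|}


section DirectionalAverage

open scoped ContDiff

universe u

variable {E F : Type*} [NormedAddCommGroup E] [NormedSpace ℝ E] [NormedAddCommGroup F]
  [NormedSpace ℝ F]

/-- The average of `f` over the segment from `x - a • v` to `x + a • v`. -/
def dirAvg (a : ℝ) (v : E) (f : E → F) (x : E) : F :=
  (2 * a)⁻¹ • ∫ t in (-a)..a, f (x + t • v)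

/-- Successive directional averages along the vectors of a list. -/
def iterAvg (a : ℝ) (L : List E) (f : E → F) : E → F :=
  L.foldr (dirAvg a) f

@[simp] lemma iterAvg_nil (a : ℝ) (f : E → F) : iterAvg a [] f = f := rfl

@[simp] lemma iterAvg_cons (a : ℝ) (v : E) (L : List E) (f : E → F) :
    iterAvg a (v :: L) f = dirAvg a v (iterAvg a L f) := rfl

lemma norm_dirAvg_le {a : ℝ} (ha : 0 < a) (v : E) {f : E → F} {M : ℝ} (hf : ∀ x, ‖f x‖ ≤ M)
    (x : E) : ‖dirAvg a v f x‖ ≤ M := by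
  have h := intervalIntegral.norm_integral_le_of_norm_le_const (a := -a) (b := a)
    (f := fun t => f (x + t • v)) (C := M) fun t _ => hf _
  rw [show a - -a = 2 * a by ring, abs_of_pos (by positivity)] at h
  rw [dirAvg, norm_smul, norm_inv, Real.norm_of_nonneg (by positivity),
    inv_mul_le_iff₀ (by positivity)]
  linarith

lemma norm_iterAvg_le {a : ℝ} (ha : 0 < a) (L : List E) {f : E → F} {M : ℝ}
    (hf : ∀ x, ‖f x‖ ≤ M) (x : E) : ‖iterAvg a L f x‖ ≤ M := by
  induction L generalizing x with
  | nil => exact hf x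
  | cons v L ih => exact norm_dirAvg_le ha v ih x

lemma hasFDerivAt_dirAvg [ProperSpace E] (a : ℝ) (v : E) {f : E → F}
    (hf : ContDiff ℝ 1 f) (x : E) :
    HasFDerivAt (dirAvg a v f) (dirAvg a v (fderiv ℝ f) x) x := by
  have hc : Continuous (fderiv ℝ f) := hf.continuous_fderiv one_ne_zero
  have hK : IsCompact (Metric.closedBall x 1 ×ˢ Set.uIcc (-a) a) :=
    (isCompact_closedBall x 1).prod isCompact_uIcc
  obtain ⟨C, hC⟩ := hK.exists_bound_of_continuousOn
    (f := fun p : E × ℝ => fderiv ℝ f (p.1 + p.2 • v)) (by fun_prop)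
  refine (intervalIntegral.hasFDerivAt_integral_of_dominated_of_fderiv_le
    (F := fun y t => f (y + t • v)) (F' := fun y t => fderiv ℝ f (y + t • v))
    (bound := fun _ => C) (Metric.closedBall_mem_nhds x one_pos) ?_ ?_ ?_ ?_ ?_ ?_).const_smul _
  · exact .of_forall fun y =>
      (hf.continuous.comp (by fun_prop : Continuous fun t : ℝ => y + t • v)).aestronglyMeasurable
  · exact (hf.continuous.comp
      (by fun_prop : Continuous fun t : ℝ => x + t • v)).intervalIntegrable _ _
  · exact (hc.comp (by fun_prop : Continuous fun t : ℝ => x + t • v)).aestronglyMeasurable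
  · exact .of_forall fun t ht y hy => hC (y, t) ⟨hy, Set.uIoc_subset_uIcc ht⟩
  · exact intervalIntegrable_const
  · exact .of_forall fun t _ y _ =>
      by
        simpa [Function.comp_def] using
          ((hf.differentiable one_ne_zero _).hasFDerivAt).comp y
            ((hasFDerivAt_id y).add_const (t • v))

lemma contDiff_dirAvg {E F : Type u} [NormedAddCommGroup E] [NormedSpace ℝ E]
    [NormedAddCommGroup F] [NormedSpace ℝ F] [ProperSpace E] (a : ℝ) (v : E) {f : E → F}
    (hf : ContDiff ℝ ∞ f) : ContDiff ℝ ∞ (dirAvg a v f) := by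
  refine contDiff_infty.2 fun n => ?_
  induction n generalizing F with
  | zero =>
    exact contDiff_zero.2 (continuous_iff_continuousAt.2 fun x =>
      (hasFDerivAt_dirAvg a v (hf.of_le (by simp)) x).continuousAt)
  | succ n ih =>
    have hd := hasFDerivAt_dirAvg a v (f := f) (hf.of_le (by simp))
    have hfd : fderiv ℝ (dirAvg a v f) = dirAvg a v (fderiv ℝ f) :=
      funext fun x => (hd x).fderiv
    push_cast
    refine contDiff_succ_iff_fderiv.2 ⟨fun x => (hd x).differentiableAt, by simp, ?_⟩
    rw [hfd]
    exact ih (hf.fderiv_right (by simp))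

lemma fderiv_dirAvg_apply [ProperSpace E] [CompleteSpace F] (a : ℝ) (v w : E) {f : E → F}
    (hf : ContDiff ℝ 1 f) (x : E) :
    fderiv ℝ (dirAvg a v f) x w = dirAvg a v (fun y => fderiv ℝ f y w) x := by
  have hc : Continuous (fderiv ℝ f) := hf.continuous_fderiv one_ne_zero
  rw [(hasFDerivAt_dirAvg a v hf x).fderiv, dirAvg, dirAvg, smul_apply,
    ContinuousLinearMap.intervalIntegral_apply]
  exact (hc.comp (by fun_prop : Continuous fun t : ℝ => x + t • v)).intervalIntegrable _ _

lemma fderiv_dirAvg_self [ProperSpace E] [CompleteSpace F] (a : ℝ) (v : E) {f : E → F}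
    (hf : ContDiff ℝ 1 f) (x : E) :
    fderiv ℝ (dirAvg a v f) x v = (2 * a)⁻¹ • (f (x + a • v) - f (x + (-a) • v)) := by
  have hc : Continuous (fderiv ℝ f) := hf.continuous_fderiv one_ne_zero
  rw [fderiv_dirAvg_apply a v v hf, dirAvg]
  congr 1
  refine intervalIntegral.integral_eq_sub_of_hasDerivAt
    (f := fun t : ℝ => f (x + t • v)) (fun t _ => ?_) ?_
  · have h1 : HasDerivAt (fun t : ℝ => x + t • v) v t := by
      simpa using ((hasDerivAt_id t).smul_const v).const_add x
    exact ((hf.differentiable one_ne_zero _).hasFDerivAt).comp_hasDerivAt t h1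
  · exact ((hc.comp (by fun_prop : Continuous fun t : ℝ => x + t • v)).clm_apply
      continuous_const).intervalIntegrable _ _

lemma contDiff_iterAvg {E F : Type u} [NormedAddCommGroup E] [NormedSpace ℝ E]
    [NormedAddCommGroup F] [NormedSpace ℝ F] [ProperSpace E] (a : ℝ) (L : List E) {f : E → F}
    (hf : ContDiff ℝ ∞ f) : ContDiff ℝ ∞ (iterAvg a L f) := by
  induction L with
  | nil => exact hf
  | cons v L ih => exact contDiff_dirAvg a v ih

variable {E F : Type u} [NormedAddCommGroup E] [NormedSpace ℝ E] [NormedAddCommGroup F]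
  [NormedSpace ℝ F] [ProperSpace E] [CompleteSpace F]

lemma fderiv_iterAvg_apply (a : ℝ) (L : List E) (w : E) {f : E → F} (hf : ContDiff ℝ ∞ f) :
    (fun x => fderiv ℝ (iterAvg a L f) x w) = iterAvg a L (fun x => fderiv ℝ f x w) := by
  induction L with
  | nil => rfl
  | cons v L ih =>
    rw [iterAvg_cons, iterAvg_cons, ← ih]
    exact funext fun x =>
      fderiv_dirAvg_apply a v w ((contDiff_iterAvg a L hf).of_le (by simp)) x

lemma norm_fderiv_iterAvg_le {a : ℝ} (ha : 0 < a) {L : List E} {w : E} (hw : w ∈ L)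
    {f : E → F} (hf : ContDiff ℝ ∞ f) {M : ℝ} (hM : ∀ x, ‖f x‖ ≤ M) (x : E) :
    ‖fderiv ℝ (iterAvg a L f) x w‖ ≤ M / a := by
  induction L generalizing x with
  | nil => simp at hw
  | cons v L ih =>
    have hL : ContDiff ℝ 1 (iterAvg a L f) := (contDiff_iterAvg a L hf).of_le (by simp)
    rw [iterAvg_cons]
    rcases List.mem_cons.1 hw with rfl | hw
    · rw [fderiv_dirAvg_self a w hL, norm_smul, norm_inv, Real.norm_of_nonneg (by positivity),
        inv_mul_le_iff₀ (by positivity)]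
      have h := norm_sub_le (iterAvg a L f (x + a • w)) (iterAvg a L f (x + (-a) • w))
      have h₁ := norm_iterAvg_le ha L hM (x + a • w)
      have h₂ := norm_iterAvg_le ha L hM (x + (-a) • w)
      have h₃ : 2 * a * (M / a) = 2 * M := by field_simp
      linarith
    · rw [fderiv_dirAvg_apply a v w hL]
      exact norm_dirAvg_le ha v (ih hw) x

end DirectionalAverage

section Coordinates

open scoped ContDiff

variable {ι : Type} [Fintype ι]

lemma LipschitzEuclid.abs_sub_le_dist {f : (ι → ℝ) → ℝ} (hf : LipschitzEuclid f) (x y : ι → ℝ) :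
    |f x - f y| ≤ √(Fintype.card ι) * dist x y := by
  refine (hf x y).trans ?_
  rw [← Real.sqrt_sq (dist_nonneg (x := x) (y := y)), ← Real.sqrt_mul (by positivity)]
  refine Real.sqrt_le_sqrt ?_
  rw [← nsmul_eq_mul]
  refine sum_le_card_nsmul _ _ _ fun i _ => ?_
  rw [← sq_abs]
  exact pow_le_pow_left₀ (abs_nonneg _) (dist_le_pi_dist x y i) 2

lemma LipschitzEuclid.continuous {f : (ι → ℝ) → ℝ} (hf : LipschitzEuclid f) : Continuous f :=
  (LipschitzWith.of_dist_le' fun x y => hf.abs_sub_le_dist x y).continuous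

lemma LipschitzEuclid.exists_contDiff_approx {f : (ι → ℝ) → ℝ} (hf : LipschitzEuclid f) {δ : ℝ}
    (hδ : 0 < δ) : ∃ g : (ι → ℝ) → ℝ, ContDiff ℝ ∞ g ∧ LipschitzEuclid g ∧
      ∀ x, |g x - f x| ≤ δ := by
  set K := √(Fintype.card ι) + 1
  have hK : 0 < K := by positivity
  let φ : ContDiffBump (0 : ι → ℝ) :=
    ⟨δ / K / 2, δ / K, by positivity, half_lt_self (by positivity)⟩
  have hfi (x : ι → ℝ) : Integrable (fun t => φ.normed volume t * f (x - t)) := by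
    refine Continuous.integrable_of_hasCompactSupport
      (φ.continuous_normed.mul (hf.continuous.comp (by fun_prop))) ?_
    exact φ.hasCompactSupport_normed.mul_right
  refine ⟨MeasureTheory.convolution (φ.normed volume) f (ContinuousLinearMap.lsmul ℝ ℝ) volume,
    φ.hasCompactSupport_normed.contDiff_convolution_left _ φ.contDiff_normed
      hf.continuous.locallyIntegrable, fun x y => ?_, fun x => ?_⟩
  · simp only [MeasureTheory.convolution, ContinuousLinearMap.lsmul_apply, smul_eq_mul]
    rw [← integral_sub (hfi x) (hfi y)]
    have hone : ∫ t, φ.normed volume t * √(∑ i, (x i - y i) ^ 2) = √(∑ i, (x i - y i) ^ 2) := by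
      rw [integral_mul_const, φ.integral_normed (μ := volume), one_mul]
    rw [← hone, ← Real.norm_eq_abs]
    refine norm_integral_le_of_norm_le
      ((φ.integrable_normed (μ := volume)).mul_const _) (.of_forall fun t => ?_)
    rw [← mul_sub, norm_mul, Real.norm_of_nonneg (φ.nonneg_normed t)]
    refine mul_le_mul_of_nonneg_left ?_ (φ.nonneg_normed t)
    simpa using hf (x - t) (y - t)
  · refine φ.dist_normed_convolution_le hf.continuous.aestronglyMeasurable fun y hy => ?_
    refine (hf.abs_sub_le_dist y x).trans ?_
    have h : dist y x ≤ δ / K := (Metric.mem_ball.1 hy).le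
    calc √(Fintype.card ι) * dist y x ≤ K * (δ / K) := by
          gcongr
          simp [K]
      _ = δ := by field_simp

variable [DecidableEq ι]

lemma pd1_eq (f : (ι → ℝ) → ℝ) (x : ι → ℝ) (i : ι) :
    pd1 f x i = fderiv ℝ f x (Pi.single i 1) := by
  rw [pd1, iteratedFDeriv_one_apply]

lemma pd2_eq {f : (ι → ℝ) → ℝ} (hf : ContDiff ℝ ∞ f) (x : ι → ℝ) (i j : ι) :
    pd2 f x i j = fderiv ℝ (fun y => fderiv ℝ f y (Pi.single j 1)) x (Pi.single i 1) := by
  have h := hf.differentiable_iteratedFDeriv (m := 1) (by exact_mod_cast ENat.natCast_lt_top 1) x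
  rw [pd2, h.iteratedFDeriv_succ_apply_left']
  simp only [iteratedFDeriv_one_apply]
  rfl

lemma pd3_eq {f : (ι → ℝ) → ℝ} (hf : ContDiff ℝ ∞ f) (x : ι → ℝ) (i j k : ι) :
    pd3 f x i j k = fderiv ℝ (fun y => fderiv ℝ (fun z => fderiv ℝ f z (Pi.single k 1)) y
      (Pi.single j 1)) x (Pi.single i 1) := by
  have h := hf.differentiable_iteratedFDeriv (m := 2) 
    (by simpa using WithTop.coe_lt_coe.2 (ENat.natCast_lt_top 2)) x
  rw [pd3, h.iteratedFDeriv_succ_apply_left']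
  simp only [← pd2_eq hf]
  rfl

lemma testD3_of_bounds {f : (ι → ℝ) → ℝ} (hf : ContDiff ℝ ∞ f) {ε : ℝ} (hε : 0 < ε)
    (h₁ : ∀ x i, |pd1 f x i| ≤ 1) (h₂ : ∀ x i j, |pd2 f x i j| ≤ 1 / ε)
    (h₃ : ∀ x i j k, |pd3 f x i j k| ≤ 1 / ε / ε) :
    TestD3 (fun x => min 1 (ε ^ 2) * f x) := by
  have hm : 0 < min 1 (ε ^ 2) := by positivity
  have hm1 : min 1 (ε ^ 2) ≤ 1 := min_le_left _ _
  have hm2 : min 1 (ε ^ 2) ≤ ε ^ 2 := min_le_right _ _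
  have hmε : min 1 (ε ^ 2) ≤ ε := by
    rcases le_total ε 1 with h | h
    · nlinarith
    · linarith
  have key : ∀ (n : ℕ) (x : ι → ℝ) (v : Fin n → ι → ℝ) (B : ℝ),
      |iteratedFDeriv ℝ n f x v| ≤ B → min 1 (ε ^ 2) * B ≤ 1 →
      |iteratedFDeriv ℝ n (fun x => min 1 (ε ^ 2) * f x) x v| ≤ 1 := by
    intro n x v B hB hmB
    have h := iteratedFDeriv_const_smul_apply (𝕜 := ℝ) (i := n) (a := min 1 (ε ^ 2)) (f := f)
      (x := x) (hf.of_le (by exact_mod_cast le_top)).contDiffAt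
    simp only [Pi.smul_def, smul_eq_mul] at h
    rw [h, smul_apply, smul_eq_mul, abs_mul, abs_of_pos hm]
    exact (mul_le_mul_of_nonneg_left hB hm.le).trans hmB
  refine ⟨contDiff_infty.1 (contDiff_const.mul hf) 3,
    fun x i => key 1 x _ 1 (h₁ x i) (by linarith),
    fun x i j => key 2 x _ _ (h₂ x i j) ?_, fun x i j k => key 3 x _ _ (h₃ x i j k) ?_⟩
  · rw [mul_one_div, div_le_one hε]
    exact hmε
  · rw [div_div, mul_one_div, div_le_one (by positivity), ← pow_two]
    exact hm2

/-- The standard basis vectors, as a list. -/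
def basisList (ι : Type) [Fintype ι] [DecidableEq ι] : List (ι → ℝ) :=
  (univ : Finset ι).toList.map fun i => Pi.single i 1

lemma single_mem_basisList (i : ι) : Pi.single i 1 ∈ basisList ι :=
  List.mem_map.2 ⟨i, by simp, rfl⟩

lemma testD3_iterAvg_iterAvg {f : (ι → ℝ) → ℝ} (hf : ContDiff ℝ ∞ f) {ε : ℝ} (hε : 0 < ε)
    (h : ∀ x i, |fderiv ℝ f x (Pi.single i 1)| ≤ 1) :
    TestD3 (fun x => min 1 (ε ^ 2) * iterAvg ε (basisList ι) (iterAvg ε (basisList ι) f) x) := by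
  set L := basisList ι
  have hp {g : (ι → ℝ) → ℝ} (hg : ContDiff ℝ ∞ g) (i : ι) :
      ContDiff ℝ ∞ (fun x => fderiv ℝ g x (Pi.single i 1)) :=
    (hg.fderiv_right (by simp)).clm_apply contDiff_const
  have hTf := contDiff_iterAvg ε L hf
  have hTTf := contDiff_iterAvg ε L hTf
  refine testD3_of_bounds hTTf hε (fun x i => ?_) (fun x i j => ?_) (fun x i j k => ?_)
  · rw [pd1_eq]
    change |(fun x => fderiv ℝ _ x _) x| ≤ 1
    rw [fderiv_iterAvg_apply ε L _ hTf, fderiv_iterAvg_apply ε L _ hf]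
    exact norm_iterAvg_le hε L
      (norm_iterAvg_le hε L fun y => (Real.norm_eq_abs _).trans_le (h y i)) x
  · rw [pd2_eq hTTf, fderiv_iterAvg_apply ε L _ hTf, fderiv_iterAvg_apply ε L _ hf]
    exact norm_fderiv_iterAvg_le hε (single_mem_basisList i)
      (contDiff_iterAvg ε L (hp hf j)) (norm_iterAvg_le hε L (h · j)) x
  · rw [pd3_eq hTTf, fderiv_iterAvg_apply ε L _ hTf, fderiv_iterAvg_apply ε L _ hf,
      fderiv_iterAvg_apply ε L _ (contDiff_iterAvg ε L (hp hf k))]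
    exact norm_fderiv_iterAvg_le hε (single_mem_basisList i)
      (hp (contDiff_iterAvg ε L (hp hf k)) j)
      (norm_fderiv_iterAvg_le hε (single_mem_basisList j) (hp hf k) (h · k)) x

lemma sum_add_smul_single_sub_sq (y x : ι → ℝ) (t : ℝ) (i : ι) :
    ∑ j, ((y + t • Pi.single i 1 : ι → ℝ) j - x j) ^ 2 =
      (∑ j, (y j - x j) ^ 2) + 2 * t * (y i - x i) + t ^ 2 := by
  have h : ∀ j, ((y + t • Pi.single i 1 : ι → ℝ) j - x j) ^ 2 =
      (y j - x j) ^ 2 + if j = i then 2 * t * (y i - x i) + t ^ 2 else 0 := by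
    intro j
    by_cases hj : j = i
    · subst hj
      simp
      ring
    · simp [hj]
  simp only [h, sum_add_distrib, sum_ite_eq', mem_univ, if_true, add_assoc]

lemma abs_dirAvg_sub_le {ε A B c : ℝ} (hε : 0 < ε) {f : (ι → ℝ) → ℝ} (hf : Continuous f)
    (x : ι → ℝ) (i : ι) (h : ∀ y, |f y - c| ≤ A * (∑ j, (y j - x j) ^ 2) + B) (y : ι → ℝ) :
    |dirAvg ε (Pi.single i 1) f y - c| ≤
      A * (∑ j, (y j - x j) ^ 2) + (B + A * (ε ^ 2 / 3)) := by
  set S := ∑ j, (y j - x j) ^ 2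
  have hfi : IntervalIntegrable (fun t : ℝ => f (y + t • Pi.single i 1)) volume (-ε) ε :=
    (hf.comp (by fun_prop)).intervalIntegrable _ _
  have heq : dirAvg ε (Pi.single i 1) f y - c =
      (2 * ε)⁻¹ * ∫ t in (-ε)..ε, (f (y + t • Pi.single i 1) - c) := by
    rw [intervalIntegral.integral_sub hfi intervalIntegrable_const,
      intervalIntegral.integral_const, dirAvg]
    simp only [smul_eq_mul]
    field_simp
    ring
  have hle : ‖∫ t in (-ε)..ε, (f (y + t • Pi.single i 1) - c)‖ ≤
      ∫ t in (-ε)..ε, (A * S + B + 2 * A * (y i - x i) * t + A * t ^ 2) := by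
    refine intervalIntegral.norm_integral_le_of_norm_le (by linarith)
      (.of_forall fun t _ => ?_) (Continuous.intervalIntegrable (by fun_prop) _ _)
    refine (h _).trans_eq ?_
    rw [sum_add_smul_single_sub_sq]
    ring
  have hval : ∫ t in (-ε)..ε, (A * S + B + 2 * A * (y i - x i) * t + A * t ^ 2) =
      2 * ε * (A * S + (B + A * (ε ^ 2 / 3))) := by
    rw [intervalIntegral.integral_add (Continuous.intervalIntegrable (by fun_prop) _ _)
      (Continuous.intervalIntegrable (by fun_prop) _ _),
      intervalIntegral.integral_add (Continuous.intervalIntegrable (by fun_prop) _ _)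
      (Continuous.intervalIntegrable (by fun_prop) _ _), intervalIntegral.integral_const_mul]
    simp only [intervalIntegral.integral_const_mul, intervalIntegral.integral_const, integral_pow,
      integral_id, smul_eq_mul]
    ring
  rw [heq, abs_mul, abs_of_pos (by positivity), inv_mul_le_iff₀ (by positivity), ← hval]
  exact hle

lemma abs_iterAvg_sub_le {ε A B c : ℝ} (hε : 0 < ε) {f : (ι → ℝ) → ℝ} (hf : ContDiff ℝ ∞ f)
    (x : ι → ℝ) (L : List ι) (h : ∀ y, |f y - c| ≤ A * (∑ j, (y j - x j) ^ 2) + B)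
    (y : ι → ℝ) :
    |iterAvg ε (L.map fun i => (Pi.single i 1 : ι → ℝ)) f y - c| ≤
      A * (∑ j, (y j - x j) ^ 2) + (B + L.length * (A * (ε ^ 2 / 3))) := by
  induction L generalizing y with
  | nil => simpa using h y
  | cons i L ih =>
    refine (abs_dirAvg_sub_le hε (contDiff_iterAvg ε _ hf).continuous x i ih y).trans_eq ?_
    push_cast [List.length_cons]
    ring

lemma LipschitzEuclid.abs_fderiv_single_le {f : (ι → ℝ) → ℝ} (hf : LipschitzEuclid f)
    (hd : Differentiable ℝ f) (x : ι → ℝ) (i : ι) : |fderiv ℝ f x (Pi.single i 1)| ≤ 1 := by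
  have h1 : HasDerivAt (fun t : ℝ => x + t • Pi.single i (1 : ℝ)) (Pi.single i 1) 0 := by
    simpa using ((hasDerivAt_id (0 : ℝ)).smul_const (Pi.single i (1 : ℝ))).const_add x
  have h2 : HasDerivAt (fun t : ℝ => f (x + t • Pi.single i (1 : ℝ)))
      (fderiv ℝ f x (Pi.single i 1)) 0 := by
    refine HasFDerivAt.comp_hasDerivAt (0 : ℝ) (l := f) ?_ h1
    simpa using (hd x).hasFDerivAt
  have hl : LipschitzWith 1 (fun t : ℝ => f (x + t • Pi.single i (1 : ℝ))) := by
    refine LipschitzWith.of_dist_le_mul fun s t => ?_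
    refine (hf _ _).trans_eq ?_
    have h := sum_add_smul_single_sub_sq (x + t • Pi.single i 1) (x + t • Pi.single i 1) (s - t) i
    rw [add_assoc, ← add_smul, add_sub_cancel] at h
    rw [h]
    simp [Real.sqrt_sq_eq_abs, Real.dist_eq]
  simpa [h2.deriv] using norm_deriv_le_of_lipschitz hl (x₀ := 0)

lemma LipschitzEuclid.exists_testD3_approx {f : (ι → ℝ) → ℝ} (hf : LipschitzEuclid f) {ε δ : ℝ}
    (hε : 0 < ε) (hδ : 0 < δ) : ∃ g : (ι → ℝ) → ℝ, TestD3 (fun x => min 1 (ε ^ 2) * g x) ∧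
      ∀ x, |g x - f x| ≤ √(Fintype.card ι) * ε + 2 * δ := by
  obtain ⟨h, hh, hhL, hhf⟩ := hf.exists_contDiff_approx hδ
  refine ⟨iterAvg ε (basisList ι) (iterAvg ε (basisList ι) h), testD3_iterAvg_iterAvg hh hε
    (hhL.abs_fderiv_single_le (hh.differentiable (by simp))), fun x => ?_⟩
  set c := √(Fintype.card ι) * ε + δ
  have hc0 : 0 < c := by positivity
  have h0 (y : ι → ℝ) : |h y - f x| ≤ 1 / (2 * c) * (∑ j, (y j - x j) ^ 2) + (δ + c / 2) := by
    have h₁ := abs_sub_le (h y) (f y) (f x)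
    have h₂ := hhf y
    have h₃ := hf y x
    have hS : 0 ≤ ∑ j, (y j - x j) ^ 2 := by positivity
    have h₄ : √(∑ j, (y j - x j) ^ 2) ≤ 1 / (2 * c) * (∑ j, (y j - x j) ^ 2) + c / 2 := by
      rw [← sub_nonneg]
      have : 1 / (2 * c) * (∑ j, (y j - x j) ^ 2) + c / 2 - √(∑ j, (y j - x j) ^ 2) =
          (√(∑ j, (y j - x j) ^ 2) - c) ^ 2 / (2 * c) := by
        rw [sub_sq, Real.sq_sqrt hS]
        field_simp
        ring
      rw [this]
      positivity
    linarith
  have h1 := abs_iterAvg_sub_le hε hh x univ.toList h0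
  have h2 := abs_iterAvg_sub_le hε (contDiff_iterAvg ε _ hh) x univ.toList h1 x
  refine h2.trans ?_
  simp only [sub_self, ne_eq, OfNat.ofNat_ne_zero, not_false_eq_true, zero_pow, sum_const_zero,
    mul_zero, zero_add, length_toList, card_univ]
  have hD : (Fintype.card ι : ℝ) * ε ^ 2 ≤ c ^ 2 := by
    have : (√(Fintype.card ι) * ε) ^ 2 ≤ c ^ 2 := by
      gcongr
      linarith
    rwa [mul_pow, Real.sq_sqrt (by positivity)] at this
  have h3 : (Fintype.card ι : ℝ) * (1 / (2 * c) * (ε ^ 2 / 3)) ≤ c / 6 := by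
    rw [show (Fintype.card ι : ℝ) * (1 / (2 * c) * (ε ^ 2 / 3)) =
      (Fintype.card ι * ε ^ 2) / (6 * c) by field_simp; ring, div_le_iff₀ (by positivity)]
    nlinarith
  linarith

lemma TestD3.abs_sub_le {f : (ι → ℝ) → ℝ} (hf : TestD3 f) (x y : ι → ℝ) :
    |f x - f y| ≤ √(Fintype.card ι) * √(∑ i, (x i - y i) ^ 2) := by
  obtain ⟨z, -, hz⟩ := domain_mvt (f := f) (f' := fderiv ℝ f) (s := Set.univ) (x := y) (y := x)
    (fun z _ => ((hf.1.differentiable (by norm_num) z).hasFDerivAt).hasFDerivWithinAt)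
    convex_univ trivial trivial
  rw [hz, ← Real.sqrt_mul (by positivity), pi_eq_sum_univ' (x - y), map_sum]
  refine Real.abs_le_sqrt ?_
  refine (sq_sum_le_card_mul_sum_sq).trans ?_
  rw [card_univ]
  refine mul_le_mul_of_nonneg_left (sum_le_sum fun i _ => ?_) (by positivity)
  rw [map_smul, smul_eq_mul, mul_pow, Pi.sub_apply]
  have h := hf.2.1 z i
  rw [pd1_eq, ← sq_le_one_iff_abs_le_one] at h
  exact mul_le_of_le_one_right (sq_nonneg _) h

end Coordinates

lemma abs_integral_comp_sub_le {Ω E : Type*} [MeasurableSpace Ω] [TopologicalSpace E]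
    [MeasurableSpace E] [BorelSpace E] {μ : Measure Ω} [IsProbabilityMeasure μ]
    {U : Ω → E} (hU : Measurable U) {f g : E → ℝ} (hf : Continuous f) (hg : Continuous g)
    {c : ℝ} (h : ∀ x, |g x - f x| ≤ c) :
    |∫ ω, g (U ω) ∂μ - ∫ ω, f (U ω) ∂μ| ≤ c := by
  have hd : Integrable (fun ω => g (U ω) - f (U ω)) μ :=
    .of_bound ((hg.measurable.comp hU).sub (hf.measurable.comp hU)).aestronglyMeasurable c
      (.of_forall fun ω => h _)
  by_cases hi : Integrable (fun ω => f (U ω)) μ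
  · have hi' : Integrable (fun ω => g (U ω)) μ := by simpa [Pi.add_def] using hd.add hi
    rw [← integral_sub hi' hi]
    simpa using norm_integral_le_of_norm_le_const (μ := μ) (f := fun ω => g (U ω) - f (U ω))
      (.of_forall fun ω => h (U ω))
  · have hi' : ¬ Integrable (fun ω => g (U ω)) μ := fun hi' =>
      hi (by simpa [Pi.sub_def] using hi'.sub hd)
    rw [integral_undef hi, integral_undef hi', sub_self, abs_zero]
    obtain ⟨ω⟩ := μ.nonempty_of_neZero
    exact (abs_nonneg _).trans (h (U ω))

/-- For any random vectors `U, V` in `ℝ^D` and every `ε > 0`,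
`d₁(U,V) ≤ 2√D ε + d₃(U,V) / min 1 ε²`. -/
theorem stmt14 {Ω : Type*} [MeasurableSpace Ω] (μ : Measure Ω) [IsProbabilityMeasure μ]
    (D : ℕ) (U V : Ω → Fin D → ℝ) (hU : Measurable U) (hV : Measurable V)
    (ε : ℝ) (hε : 0 < ε) :
    d1 μ U V ≤ 2 * Real.sqrt D * ε + d3 μ U V / min 1 (ε ^ 2) := by
  have hm : 0 < min 1 (ε ^ 2) := by positivity
  have hd3 : 0 ≤ d3 μ U V := by
    refine Real.sSup_nonneg ?_
    rintro _ ⟨ζ, -, rfl⟩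
    exact abs_nonneg _
  by_cases hb : BddAbove {r | ∃ ζ : (Fin D → ℝ) → ℝ, LipschitzEuclid ζ ∧
      r = |(∫ ω, ζ (U ω) ∂μ) - ∫ ω, ζ (V ω) ∂μ|}
  swap
  · rw [d1, Real.sSup_of_not_bddAbove hb]
    positivity
  have hb3 : BddAbove {r | ∃ ζ : (Fin D → ℝ) → ℝ, TestD3 ζ ∧
      r = |(∫ ω, ζ (U ω) ∂μ) - ∫ ω, ζ (V ω) ∂μ|} := by
    obtain ⟨C, hC⟩ := hb
    have hK : 0 < √D + 1 := by positivity
    refine ⟨(√D + 1) * C, ?_⟩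
    rintro _ ⟨ζ, hζ, rfl⟩
    have hL : LipschitzEuclid fun x => (√D + 1)⁻¹ * ζ x := fun x y => by
      rw [← mul_sub, abs_mul, abs_of_pos (by positivity), inv_mul_le_iff₀ hK]
      refine (hζ.abs_sub_le x y).trans ?_
      rw [Fintype.card_fin]
      gcongr
      linarith
    have h := hC ⟨_, hL, rfl⟩
    rwa [integral_const_mul, integral_const_mul, ← mul_sub, abs_mul, abs_of_pos (by positivity),
      inv_mul_le_iff₀ hK] at h
  refine Real.sSup_le ?_ (by positivity)
  rintro _ ⟨ζ, hζ, rfl⟩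
  refine le_of_forall_pos_le_add fun δ hδ => ?_
  obtain ⟨g, hg, hgζ⟩ := hζ.exists_testD3_approx hε (show 0 < δ / 4 by positivity)
  rw [Fintype.card_fin] at hgζ
  have hgc : Continuous g := by
    have h := (continuous_const (y := (min 1 (ε ^ 2))⁻¹)).mul hg.1.continuous
    simpa only [Pi.mul_def, inv_mul_cancel_left₀ hm.ne'] using h
  have hgd : |(∫ ω, g (U ω) ∂μ) - ∫ ω, g (V ω) ∂μ| ≤ d3 μ U V / min 1 (ε ^ 2) := by
    have h := le_csSup hb3 ⟨_, hg, rfl⟩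
    rw [integral_const_mul, integral_const_mul, ← mul_sub, abs_mul, abs_of_pos hm] at h
    rwa [le_div_iff₀' hm]
  have hUg := abs_le.1 (abs_integral_comp_sub_le (μ := μ) hU hζ.continuous hgc hgζ)
  have hVg := abs_le.1 (abs_integral_comp_sub_le (μ := μ) hV hζ.continuous hgc hgζ)
  have hUV := abs_le.1 hgd
  rw [abs_le]
  constructor <;> linarith

end
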